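/- arXiv:1804.09432 — 4 statements merged into one kernel-verified Lean document; each statement's English description precedes it below -/
import Mathlib

section
/- Let G be a group acting by isometries, uniformly properly, on a nonempty Gromov hyperbolic length space X with bounded geometry. Then there exist a type V, a free action of G on V, and a G-invariant simple graph Γ on the vertex set V (i.e. g • v adjacent to g • w whenever v adjacent to w) such that Γ is connected, the degrees of vertices of Γ are bounded above by a uniform constant d ∈ ℕ, and the graph metric of Γ (viewed as a real-valued metric on V) is Gromov hyperbolic. -/
/-- The Gromov product of `x` and `y` seen from the basepoint `t`:
`(x|y)_t = ½(dist(x,t) + dist(y,t) − dist(x,y))`. -/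
noncomputable def gromovProduct {X : Type*} [MetricSpace X] (t x y : X) : ℝ :=
  (dist x t + dist y t - dist x y) / 2

/-- A metric space is Gromov hyperbolic if there is `δ ≥ 0` such that the
four-point inequality `(x|z)_t ≥ min((x|y)_t, (y|z)_t) − δ` holds. -/
def IsGromovHyperbolic (X : Type*) [MetricSpace X] : Prop :=
  ∃ δ : ℝ, 0 ≤ δ ∧ ∀ x y z t : X,
    gromovProduct t x z ≥ min (gromovProduct t x y) (gromovProduct t y z) - δ

/-- The Gromov product with respect to an abstract distance function `d`. -/
noncomputable def gromovProductFun {V : Type*} (d : V → V → ℝ) (t x y : V) : ℝ :=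
  (d x t + d y t - d x y) / 2

/-- Gromov hyperbolicity of an abstract distance function `d` on a set `V`. -/
def IsGromovHyperbolicFun {V : Type*} (d : V → V → ℝ) : Prop :=
  ∃ δ : ℝ, 0 ≤ δ ∧ ∀ x y z t : V,
    gromovProductFun d t x z ≥ min (gromovProductFun d t x y) (gromovProductFun d t y z) - δ

/-- A subset `S` is `r`-separated if distinct points of `S` are at distance at least `r`. -/
def IsSeparatedSubset {X : Type*} [MetricSpace X] (r : ℝ) (S : Set X) : Prop :=
  ∀ s ∈ S, ∀ s' ∈ S, s ≠ s' → r ≤ dist s s'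

/-- A metric space has bounded geometry if for some `r > 0`, for every `R > 0` there is
`N ∈ ℕ` bounding the cardinality of every `r`-separated subset of every ball of radius `R`. -/
def HasBoundedGeometry (X : Type*) [MetricSpace X] : Prop :=
  ∃ r : ℝ, 0 < r ∧ ∀ R : ℝ, 0 < R → ∃ N : ℕ,
    ∀ (x : X) (S : Set X), S ⊆ Metric.closedBall x R → IsSeparatedSubset r S →
      S.encard ≤ N

/-- An action of `G` on `X` is uniformly proper if for every `r ≥ 0` there is `N ∈ ℕ`
such that for every `x ∈ X`, at most `N` elements `g ∈ G` satisfy `dist(x, g • x) ≤ r`. -/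
def UniformlyProper (G X : Type*) [Group G] [MetricSpace X] [MulAction G X] : Prop :=
  ∀ r : ℝ, 0 ≤ r → ∃ N : ℕ, ∀ x : X, {g : G | dist x (g • x) ≤ r}.encard ≤ N

/-- A metric space is a length space: for all `x, y` and `ε > 0` there is a chain of points
from `x` to `y` with consecutive distances at most `ε` whose total length is at most
`dist x y + ε`. -/
def IsLengthSpace (X : Type*) [MetricSpace X] : Prop :=
  ∀ x y : X, ∀ ε : ℝ, 0 < ε → ∃ (n : ℕ) (p : ℕ → X),
    p 0 = x ∧ p n = y ∧ (∀ i < n, dist (p i) (p (i + 1)) ≤ ε) ∧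
    (∑ i ∈ Finset.range n, dist (p i) (p (i + 1))) ≤ dist x y + ε

namespace GH

theorem exists_jump (P : ℕ → Prop) (m : ℕ) (h0 : ¬ P 0) (hm : P m) :
    ∃ a, a < m ∧ ¬ P a ∧ P (a + 1) := by
  induction m with
  | zero => exact absurd hm h0
  | succ k ih =>
    by_cases hk : P k
    · obtain ⟨a, ha, h⟩ := ih hk
      exact ⟨a, by omega, h⟩
    · exact ⟨k, by omega, hk, hm⟩

theorem growth (a b : ℝ) : ∃ k0 : ℕ, ∀ k : ℕ, k0 ≤ k → a * k + b ≤ 2 ^ k := by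
  have h1 := (tendsto_pow_const_div_const_pow_of_one_lt 1 (r := 2) (by norm_num)).const_mul a
  have h2 := (tendsto_pow_const_div_const_pow_of_one_lt 0 (r := 2) (by norm_num)).const_mul b
  have h3 := h1.add h2
  simp only [mul_zero, add_zero] at h3
  have h4 := h3.eventually (gt_mem_nhds (show (0 : ℝ) < 1 by norm_num))
  obtain ⟨k0, hk0⟩ := Filter.eventually_atTop.1 h4
  refine ⟨k0, fun k hk => ?_⟩
  have h5 := hk0 k hk
  have hp : (0 : ℝ) < 2 ^ k := by positivity
  have h6 : a * ((k : ℝ) ^ 1 / 2 ^ k) + b * ((k : ℝ) ^ 0 / 2 ^ k) = (a * k + b) / 2 ^ k := by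
    field_simp
  rw [h6, div_lt_one hp] at h5
  exact h5.le

variable {X : Type*} [MetricSpace X]

theorem gp_comm (t x y : X) : gromovProduct t x y = gromovProduct t y x := by
  unfold gromovProduct
  rw [dist_comm x y]; ring

/-- Four point inequality. -/
theorem four_point {δ : ℝ}
    (H : ∀ x y z t : X,
      gromovProduct t x z ≥ min (gromovProduct t x y) (gromovProduct t y z) - δ)
    (x y z t : X) :
    dist x z + dist y t ≤ dist x y + dist z t + 2 * δ ∨
      dist x z + dist y t ≤ dist y z + dist x t + 2 * δ := by
  have h := H x y z t
  unfold gromovProduct at h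
  rcases min_cases ((dist x t + dist y t - dist x y) / 2)
    ((dist y t + dist z t - dist y z) / 2) with ⟨h1, _⟩ | ⟨h1, _⟩
  · left; rw [h1] at h; linarith
  · right; rw [h1] at h; linarith

theorem chain_product {δ : ℝ}
    (H : ∀ x y z t : X,
      gromovProduct t x z ≥ min (gromovProduct t x y) (gromovProduct t y z) - δ)
    {L : ℝ} (hL : 0 ≤ L) (p : X) (D : ℝ) (k : ℕ) :
    ∀ (n : ℕ) (q : ℕ → X), n ≤ 2 ^ k → (∀ i ≤ n, D ≤ dist (q i) p) →
      (∀ i < n, dist (q i) (q (i + 1)) ≤ L) →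
      D - L / 2 - k * δ ≤ gromovProduct p (q 0) (q n) := by
  induction k with
  | zero =>
    intro n q hn hD hs
    have : n = 0 ∨ n = 1 := by
      simp at hn; omega
    rcases this with rfl | rfl
    · have := hD 0 le_rfl
      simp only [gromovProduct, dist_self]
      push_cast; linarith
    · have h0 := hD 0 (by omega)
      have h1 := hD 1 le_rfl
      have h2 := hs 0 (by omega)
      simp only [gromovProduct]
      simp only [zero_add] at h2
      push_cast; linarith
  | succ k ih =>
    intro n q hn hD hs
    rw [pow_succ] at hn
    have e1 := ih (n / 2) q (by omega) (fun i hi => hD i (by omega)) (fun i hi => hs i (by omega))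
    have e2 := ih (n - n / 2) (fun i => q (n / 2 + i)) (by omega) (fun i hi => hD _ (by omega))
      (fun i hi => hs _ (by omega))
    simp only [add_zero] at e2
    rw [show n / 2 + (n - n / 2) = n by omega] at e2
    have e3 := H (q 0) (q (n / 2)) (q n) p
    have e4 := le_min e1 e2
    push_cast
    linarith

theorem length_chain (hl : IsLengthSpace X) (x y : X) (ε : ℝ) (hε : 0 < ε) :
    ∃ (n : ℕ) (p : ℕ → X), p 0 = x ∧ p n = y ∧ (∀ i < n, dist (p i) (p (i + 1)) ≤ ε) ∧
      ∀ i j k, i ≤ j → j ≤ k → k ≤ n →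
        dist (p i) (p j) + dist (p j) (p k) ≤ dist (p i) (p k) + ε := by
  obtain ⟨n, p, h0, hn, hs, hsum⟩ := hl x y ε hε
  refine ⟨n, p, h0, hn, hs, fun i j k hij hjk hkn => ?_⟩
  have a1 := dist_le_Ico_sum_dist p (Nat.zero_le i)
  have a2 := dist_le_Ico_sum_dist p hij
  have a3 := dist_le_Ico_sum_dist p hjk
  have a4 := dist_le_Ico_sum_dist p hkn
  rw [Finset.range_eq_Ico, ← Finset.sum_Ico_consecutive _ (Nat.zero_le i) (hij.trans (hjk.trans hkn)),
    ← Finset.sum_Ico_consecutive _ hij (hjk.trans hkn),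
    ← Finset.sum_Ico_consecutive _ hjk hkn] at hsum
  have b1 := dist_triangle (p 0) (p i) (p n)
  have b2 := dist_triangle (p i) (p k) (p n)
  rw [h0, hn] at b1
  rw [h0] at a1
  rw [hn] at a4 b2
  linarith

/-- Points of a rough geodesic are close to any quasi-geodesic with the same ends. -/
theorem morse_one {δ : ℝ} (hδ : 0 ≤ δ)
    (H : ∀ x y z t : X,
      gromovProduct t x z ≥ min (gromovProduct t x y) (gromovProduct t y z) - δ)
    {L A B : ℝ} (hL : 0 ≤ L) (hA : 0 ≤ A) :
    ∃ D0 : ℝ, 0 ≤ D0 ∧ ∀ (n m : ℕ) (u p : ℕ → X),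
      (∀ i < n, dist (u i) (u (i + 1)) ≤ L) →
      (∀ i j, i ≤ j → j ≤ n → (j : ℝ) - i ≤ A * dist (u i) (u j) + B) →
      p 0 = u 0 → p m = u n →
      (∀ i < m, dist (p i) (p (i + 1)) ≤ 1) →
      (∀ i j k, i ≤ j → j ≤ k → k ≤ m →
        dist (p i) (p j) + dist (p j) (p k) ≤ dist (p i) (p k) + 1) →
      ∀ i ≤ m, ∃ j ≤ n, dist (p i) (u j) ≤ D0 := by
  set M : ℝ := 2 * (δ + 1) with hM
  have hMpos : 0 < M := by positivity
  obtain ⟨k0, hk0⟩ := growth (6 * M * A) (6 * M * A + 2 * A + B)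
  refine ⟨M * (k0 + 1) + 1 + 4 * δ + L, by positivity, ?_⟩
  intro n m u p hstep hqg hp0 hpm hps hpg
  have hJ : ∀ i, ∃ j ≤ n, ∀ j' ≤ n, dist (p i) (u j) ≤ dist (p i) (u j') := by
    intro i
    obtain ⟨j, hj, hj'⟩ := Finset.exists_min_image (Finset.range (n + 1))
      (fun j => dist (p i) (u j)) ⟨0, by simp⟩
    exact ⟨j, by simpa [Nat.lt_succ_iff] using hj,
      fun j' h => hj' j' (by simpa [Nat.lt_succ_iff] using h)⟩
  choose J hJn hJmin using hJ
  obtain ⟨c, hc, hcmax⟩ := Finset.exists_max_image (Finset.range (m + 1))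
      (fun i => dist (p i) (u (J i))) ⟨0, by simp⟩
  have hcm : c ≤ m := by simpa [Nat.lt_succ_iff] using hc
  set D := dist (p c) (u (J c)) with hD
  have hfar : ∀ j ≤ n, D ≤ dist (u j) (p c) := fun j hj => by
    rw [dist_comm]; exact hJmin c j hj
  have hnear : ∀ i ≤ m, dist (p i) (u (J i)) ≤ D := fun i hi =>
    hcmax i (by simpa [Nat.lt_succ_iff] using hi)
  have hD0 : 0 ≤ D := dist_nonneg
  suffices hmain : D ≤ M * (k0 + 1) + 1 + 4 * δ + L from
    fun i hi => ⟨J i, hJn i, (hnear i hi).trans hmain⟩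
  have hleft : ∃ a ≤ c, ∃ j ≤ n, dist (p a) (p c) ≤ 2 * D + 1 ∧ dist (p a) (u j) ≤ D ∧
      D ≤ gromovProduct (p c) (p a) (u j) := by
    by_cases h : dist (p 0) (p c) ≤ 2 * D + 1
    · refine ⟨0, by omega, 0, by omega, h, by rw [hp0, dist_self]; exact hD0, ?_⟩
      have := hfar 0 (by omega)
      rw [hp0, gromovProduct, dist_self]; linarith
    · obtain ⟨a, ha, h1, h2⟩ := exists_jump (fun i => dist (p i) (p c) ≤ 2 * D + 1) c h
        (by simp only [dist_self]; linarith)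
      refine ⟨a + 1, by omega, J (a + 1), hJn _, h2, hnear _ (by omega), ?_⟩
      have e1 := hnear (a + 1) (by omega)
      have e2 := hfar (J (a + 1)) (hJn _)
      have e3 := hps a (by omega)
      have e4 := dist_triangle (p a) (p (a + 1)) (p c)
      rw [gromovProduct]; linarith
  have hright : ∃ b, c ≤ b ∧ b ≤ m ∧ ∃ j ≤ n, dist (p b) (p c) ≤ 2 * D + 1 ∧
      dist (p b) (u j) ≤ D ∧ D ≤ gromovProduct (p c) (p b) (u j) := by
    by_cases h : dist (p m) (p c) ≤ 2 * D + 1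
    · refine ⟨m, hcm, le_rfl, n, le_rfl, h, by rw [hpm, dist_self]; exact hD0, ?_⟩
      have := hfar n le_rfl
      rw [hpm, gromovProduct, dist_self]; linarith
    · obtain ⟨a, ha, h1, h2⟩ := exists_jump (fun i => ¬ dist (p (c + i)) (p c) ≤ 2 * D + 1) (m - c)
        (by simp only [add_zero, dist_self, not_not]; linarith)
        (by rw [show c + (m - c) = m by omega]; exact h)
      simp only [not_not] at h1 h2
      refine ⟨c + a, by omega, by omega, J (c + a), hJn _, h1, hnear _ (by omega), ?_⟩
      have e1 := hnear (c + a) (by omega)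
      have e2 := hfar (J (c + a)) (hJn _)
      have e3 := hps (c + a) (by omega)
      have e4 := dist_triangle (p (c + (a + 1))) (p (c + a)) (p c)
      rw [dist_comm (p (c + (a + 1))) (p (c + a)), ← add_assoc] at e4
      rw [← add_assoc] at h2
      rw [gromovProduct]; linarith
  obtain ⟨a, hac, j1, hj1, l1, l2, l3⟩ := hleft
  obtain ⟨b, hcb, hbm, j2, hj2, r1, r2, r3⟩ := hright
  have hgeo : gromovProduct (p c) (p a) (p b) ≤ 1 / 2 := by
    have := hpg a c b hac hcb hbm
    rw [gromovProduct, dist_comm (p b)]; linarith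
  have hdz : dist (u j1) (u j2) ≤ 6 * D + 2 := by
    have t1 := dist_triangle (u j1) (p a) (u j2)
    have t2 := dist_triangle (p a) (p b) (u j2)
    have t3 := dist_triangle (p a) (p c) (p b)
    rw [dist_comm (u j1) (p a)] at t1
    rw [dist_comm (p c) (p b)] at t3
    linarith
  set k := ⌊D / M⌋₊ with hk
  have hkle : (k : ℝ) * M ≤ D := by
    rw [← le_div_iff₀ hMpos]; exact Nat.floor_le (by positivity)
  have hklt : D ≤ M * (k + 1) := by
    have := (Nat.lt_floor_add_one (D / M)).le
    rw [div_le_iff₀ hMpos] at this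
    linarith
  by_cases hkk : k0 ≤ k
  · have hgr := hk0 k hkk
    have hlen : ∀ i j, i ≤ j → j ≤ n → dist (u i) (u j) ≤ 6 * D + 2 → j - i ≤ 2 ^ k := by
      intro i j hij hjn hd
      have q1 := hqg i j hij hjn
      have q2 : A * dist (u i) (u j) ≤ A * (6 * (M * (k + 1)) + 2) :=
        mul_le_mul_of_nonneg_left (by linarith) hA
      have : ((j - i : ℕ) : ℝ) ≤ ((2 ^ k : ℕ) : ℝ) := by
        push_cast [hij]; nlinarith
      exact_mod_cast this
    have hz : ∀ i j, i ≤ j → j ≤ n → dist (u i) (u j) ≤ 6 * D + 2 →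
        D - L / 2 - k * δ ≤ gromovProduct (p c) (u i) (u j) := by
      intro i j hij hjn hd
      have := chain_product H hL (p c) D k (j - i) (fun s => u (i + s)) (hlen i j hij hjn hd)
        (fun s hs => hfar _ (by omega)) (fun s hs => hstep _ (by omega))
      simpa [show i + (j - i) = j by omega] using this
    have hzz : D - L / 2 - k * δ ≤ gromovProduct (p c) (u j1) (u j2) := by
      rcases le_total j1 j2 with h | h
      · exact hz j1 j2 h hj2 hdz
      · rw [gp_comm]; exact hz j2 j1 h hj1 (by rw [dist_comm]; exact hdz)
    have hkδ : 0 ≤ (k : ℝ) * δ := by positivity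
    have f1 := H (u j1) (u j2) (p b) (p c)
    rw [gp_comm _ (p b)] at r3
    have f2 := le_min hzz
      (show D - L / 2 - k * δ ≤ gromovProduct (p c) (u j2) (p b) by linarith)
    have f3 := H (p a) (u j1) (p b) (p c)
    have f4 := le_min
      (show D - L / 2 - k * δ - δ ≤ gromovProduct (p c) (p a) (u j1) by linarith)
      (show D - L / 2 - k * δ - δ ≤ gromovProduct (p c) (u j1) (p b) by linarith)
    have f5 : D - L / 2 - k * δ - 2 * δ ≤ 1 / 2 := by
      linarith [f3, f4, l3]
    have f6 : (k : ℝ) * δ ≤ D / 2 := by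
      have : (k : ℝ) * M = 2 * (k * δ) + 2 * k := by rw [hM]; ring
      have : (0 : ℝ) ≤ k := by positivity
      linarith
    have : 0 ≤ M * (k0 + 1) := by positivity
    linarith
  · have : (k : ℝ) ≤ k0 := by exact_mod_cast (not_le.1 hkk).le
    have : M * (k + 1) ≤ M * (k0 + 1) := by gcongr
    linarith

/-- The Morse lemma. -/
theorem morse_two {δ : ℝ} (hδ : 0 ≤ δ)
    (H : ∀ x y z t : X,
      gromovProduct t x z ≥ min (gromovProduct t x y) (gromovProduct t y z) - δ)
    (hl : IsLengthSpace X)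
    {L A B : ℝ} (hL : 0 ≤ L) (hA : 0 ≤ A) (hB : 0 ≤ B) :
    ∃ K : ℝ, 0 ≤ K ∧ ∀ (n : ℕ) (u : ℕ → X),
      (∀ i < n, dist (u i) (u (i + 1)) ≤ L) →
      (∀ i j, i ≤ j → j ≤ n → (j : ℝ) - i ≤ A * dist (u i) (u j) + B) →
      ∀ i ≤ n, dist (u 0) (u i) + dist (u i) (u n) ≤ dist (u 0) (u n) + K := by
  obtain ⟨D0, hD0, hD⟩ := morse_one (B := B) hδ H hL hA
  refine ⟨1 + 2 * ((A * (2 * D0 + 1) + B) * L + D0), by positivity, ?_⟩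
  intro n u hs hqg i hi
  obtain ⟨m, p, hp0, hpm, hps, hpg⟩ := length_chain hl (u 0) (u n) 1 one_pos
  have hc := hD n m u p hs hqg hp0 hpm hps hpg
  have key : ∃ a ≤ m, ∃ j k, j ≤ i ∧ i ≤ k ∧ k ≤ n ∧ dist (p a) (u j) ≤ D0 ∧
      dist (u j) (u k) ≤ 2 * D0 + 1 := by
    by_cases h0 : ∃ k, i ≤ k ∧ k ≤ n ∧ dist (p 0) (u k) ≤ D0
    · obtain ⟨k, hik, hkn, hk⟩ := h0
      refine ⟨0, by omega, 0, k, by omega, hik, hkn, by rw [hp0, dist_self]; exact hD0, ?_⟩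
      rw [hp0] at hk; linarith
    · obtain ⟨a, ha, h1, k, hik, hkn, hk⟩ := exists_jump
        (fun s => ∃ k, i ≤ k ∧ k ≤ n ∧ dist (p s) (u k) ≤ D0) m h0
        ⟨n, hi, le_rfl, by rw [hpm, dist_self]; exact hD0⟩
      obtain ⟨j, hj, hjd⟩ := hc a ha.le
      have hji : j ≤ i := by
        by_contra hh
        exact h1 ⟨j, by omega, hj, hjd⟩
      refine ⟨a, ha.le, j, k, hji, hik, hkn, hjd, ?_⟩
      have t1 := dist_triangle (u j) (p a) (u k)
      have t2 := dist_triangle (p a) (p (a + 1)) (u k)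
      have t3 := hps a ha
      rw [dist_comm (u j) (p a)] at t1
      linarith
  obtain ⟨a, ham, j, k, hji, hik, hkn, d1, d2⟩ := key
  have hkj := hqg j k (hji.trans hik) hkn
  have hkj' : A * dist (u j) (u k) ≤ A * (2 * D0 + 1) := mul_le_mul_of_nonneg_left d2 hA
  have hij : dist (u j) (u i) ≤ (A * (2 * D0 + 1) + B) * L := by
    have h1 : dist (u j) (u i) ≤ ∑ s ∈ Finset.Ico j i, L :=
      dist_le_Ico_sum_of_dist_le hji (fun {s} _ hs2 => hs s (by omega))
    simp only [Finset.sum_const, Nat.card_Ico, nsmul_eq_mul] at h1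
    refine h1.trans (mul_le_mul_of_nonneg_right ?_ hL)
    have : (i : ℝ) ≤ k := by exact_mod_cast hik
    push_cast [hji]; linarith
  have g := hpg 0 a m (by omega) ham le_rfl
  rw [hp0, hpm] at g
  have t1 := dist_triangle (p a) (u j) (u i)
  have t2 := dist_triangle (u 0) (p a) (u i)
  have t3 := dist_triangle (u i) (p a) (u n)
  rw [dist_comm (u i) (p a)] at t3
  linarith

/-- Slim triangles imply the four point condition. -/
theorem slim_hyperbolic {V : Type*} (d : V → V → ℝ) (hself : ∀ x, d x x = 0)
    (hcomm : ∀ x y, d x y = d y x) (htri : ∀ x y z, d x z ≤ d x y + d y z)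
    (hpath : ∀ x y, ∃ (n : ℕ) (u : ℕ → V), u 0 = x ∧ u n = y ∧
      (∀ i ≤ n, d x (u i) + d (u i) y = d x y) ∧ ∀ i < n, d (u i) (u (i + 1)) ≤ 1)
    (C : ℝ) (hC : 0 ≤ C)
    (hslim : ∀ x y z p, d x p + d p y = d x y → ∃ q, d p q ≤ C ∧
      (d x q + d q z = d x z ∨ d z q + d q y = d z y)) :
    IsGromovHyperbolicFun d := by
  have hproj : ∀ t x y, ∃ q, d x q + d q y = d x y ∧
      d q t ≤ gromovProductFun d t x y + 2 * (C + 1) := by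
    intro t x y
    obtain ⟨n, u, h0, hn, hu, hs⟩ := hpath x y
    have key : ∃ q a b, d x q + d q y = d x y ∧ d q a ≤ C + 1 ∧ d q b ≤ C + 1 ∧
        d x a + d a t = d x t ∧ d t b + d b y = d t y := by
      by_cases hP : ∃ b, d (u 0) b ≤ C ∧ d t b + d b y = d t y
      · obtain ⟨b, hb, hb'⟩ := hP
        rw [h0] at hb
        refine ⟨x, x, b, ?_, ?_, ?_, ?_, hb'⟩
        · rw [hself]; ring
        · rw [hself]; linarith
        · linarith
        · rw [hself]; ring
      · obtain ⟨a, ha, h1, b, hb, hb'⟩ := exists_jump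
          (fun i => ∃ b, d (u i) b ≤ C ∧ d t b + d b y = d t y) n hP
          ⟨y, by rw [hn, hself]; exact hC, by rw [hself]; ring⟩
        obtain ⟨q, hq, hq'⟩ := hslim x y t (u a) (hu a ha.le)
        rcases hq' with hq' | hq'
        · refine ⟨u a, q, b, hu a ha.le, by linarith, ?_, hq', hb'⟩
          have := htri (u a) (u (a + 1)) b
          have := hs a ha
          linarith
        · exact absurd ⟨q, hq, hq'⟩ h1
    obtain ⟨q, a, b, hq, ha, hb, ha', hb'⟩ := key
    refine ⟨q, hq, ?_⟩
    unfold gromovProductFun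
    have t1 := htri x a q
    have t2 := htri q a t
    have t3 := htri q b t
    have t4 := htri q b y
    rw [hcomm a q] at t1
    rw [hcomm b t] at t3
    rw [hcomm y t]
    linarith
  refine ⟨2 * (C + 1) + C, by positivity, fun x y z t => ?_⟩
  obtain ⟨q, hq, hqt⟩ := hproj t x z
  obtain ⟨q', hq', h⟩ := hslim x z y q hq
  have hle : ∀ a b, d a q' + d q' b = d a b → gromovProductFun d t a b ≤ d q' t := by
    intro a b hab
    unfold gromovProductFun
    have t1 := htri a q' t
    have t2 := htri b q' t
    rw [hcomm b q'] at t2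
    linarith
  have t1 := htri q' q t
  rw [hcomm q' q] at t1
  rcases h with h | h
  · have := hle x y h
    have := min_le_left (gromovProductFun d t x y) (gromovProductFun d t y z)
    linarith
  · have := hle y z h
    have := min_le_right (gromovProductFun d t x y) (gromovProductFun d t y z)
    linarith

theorem graph_geo {V : Type*} {Γ : SimpleGraph V} (hc : Γ.Connected) (x p y : V)
    (h : Γ.dist x p + Γ.dist p y = Γ.dist x y) :
    ∃ u : ℕ → V, u 0 = x ∧ u (Γ.dist x p) = p ∧ u (Γ.dist x y) = y ∧
      ∀ i j, i ≤ j → j ≤ Γ.dist x y → i + Γ.dist (u i) (u j) = j := by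
  obtain ⟨w1, hw1⟩ := hc.exists_walk_length_eq_dist x p
  obtain ⟨w2, hw2⟩ := hc.exists_walk_length_eq_dist p y
  have hlen : (w1.append w2).length = Γ.dist x y := by
    rw [SimpleGraph.Walk.length_append]; omega
  have hend : (w1.append w2).getVert (Γ.dist x y) = y := by
    rw [← hlen, SimpleGraph.Walk.getVert_length]
  refine ⟨(w1.append w2).getVert, by simp, ?_, hend, ?_⟩
  · rw [SimpleGraph.Walk.getVert_append, ← hw1]; simp
  · generalize (w1.append w2) = w at hlen hend
    have hup : ∀ i k, i + k ≤ Γ.dist x y → Γ.dist (w.getVert i) (w.getVert (i + k)) ≤ k := by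
      intro i k
      induction k with
      | zero => intro _; simp
      | succ k ih =>
        intro hk
        have h1 := ih (by omega)
        have h2 := hc.dist_triangle (u := w.getVert i) (v := w.getVert (i + k))
          (w := w.getVert (i + k + 1))
        have h3 := SimpleGraph.dist_eq_one_iff_adj.2
          (w.adj_getVert_succ (i := i + k) (by omega))
        rw [← add_assoc]
        omega
    intro i j hij hj
    have a1 := hup 0 i (by omega)
    have a2 := hup i (j - i) (by omega)
    have a3 := hup j (Γ.dist x y - j) (by omega)
    rw [zero_add, SimpleGraph.Walk.getVert_zero] at a1
    rw [show i + (j - i) = j by omega] at a2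
    rw [show j + (Γ.dist x y - j) = Γ.dist x y by omega, hend] at a3
    have b1 := hc.dist_triangle (u := x) (v := w.getVert i) (w := y)
    have b2 := hc.dist_triangle (u := w.getVert i) (v := w.getVert j) (w := y)
    omega

/-- A graph quasi-isometrically embedded in a hyperbolic length space is hyperbolic. -/
theorem graph_hyperbolic (hhyp : IsGromovHyperbolic X) (hl : IsLengthSpace X)
    {V : Type*} {Γ : SimpleGraph V} (hc : Γ.Connected) (f : V → X)
    {L A B : ℝ} (hL : 0 ≤ L) (hA : 0 ≤ A) (hB : 0 ≤ B)
    (hlip : ∀ v w, dist (f v) (f w) ≤ L * Γ.dist v w)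
    (hco : ∀ v w, (Γ.dist v w : ℝ) ≤ A * dist (f v) (f w) + B) :
    IsGromovHyperbolicFun (fun v w : V => (Γ.dist v w : ℝ)) := by
  obtain ⟨δ, hδ, H⟩ := hhyp
  obtain ⟨K, hK, hM⟩ := morse_two hδ H hl hL hA hB
  have hbet : ∀ x p y, Γ.dist x p + Γ.dist p y = Γ.dist x y →
      dist (f x) (f p) + dist (f p) (f y) ≤ dist (f x) (f y) + K := by
    intro x p y h
    obtain ⟨u, h0, h1, h2, h3⟩ := graph_geo hc x p y h
    have := hM (Γ.dist x y) (fun i => f (u i)) ?_ ?_ (Γ.dist x p) (by omega)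
    · simpa only [h0, h1, h2] using this
    · intro i hi
      have e := h3 i (i + 1) (by omega) (by omega)
      have e' : Γ.dist (u i) (u (i + 1)) = 1 := by omega
      have := hlip (u i) (u (i + 1))
      rw [e'] at this
      simpa using this
    · intro i j hij hj
      have e := h3 i j hij hj
      have e' : (i : ℝ) + Γ.dist (u i) (u j) = j := by exact_mod_cast e
      have := hco (u i) (u j)
      linarith
  -- points roughly between are close to the interval
  have hclose : ∀ K', 0 ≤ K' → ∀ x p z, dist (f x) (f p) + dist (f p) (f z) ≤
      dist (f x) (f z) + K' → ∃ q, Γ.dist x q + Γ.dist q z = Γ.dist x z ∧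
        dist (f p) (f q) ≤ K + K' + (K' + L) + 2 * δ := by
    intro K' hK' x p z hp
    have hq : ∃ q, Γ.dist x q + Γ.dist q z = Γ.dist x z ∧
        |dist (f x) (f q) - dist (f x) (f p)| ≤ K' + L := by
      by_cases hb : dist (f x) (f z) ≤ dist (f x) (f p)
      · refine ⟨z, by simp, ?_⟩
        have := dist_nonneg (x := f p) (y := f z)
        rw [abs_le]; constructor <;> linarith
      · obtain ⟨u, h0, -, h2, h3⟩ := graph_geo hc x x z (by simp)
        obtain ⟨a, ha, g1, g2⟩ := exists_jump (fun i => dist (f x) (f p) < dist (f x) (f (u i)))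
          (Γ.dist x z) (by simp only [h0, dist_self, not_lt]; exact dist_nonneg)
          (by simp only [h2]; exact not_le.1 hb)
        refine ⟨u a, ?_, ?_⟩
        · have e1 := h3 0 a (by omega) (by omega)
          have e2 := h3 a (Γ.dist x z) (by omega) le_rfl
          rw [h0] at e1
          rw [h2] at e2
          omega
        · have e := h3 a (a + 1) (by omega) (by omega)
          have e' : Γ.dist (u a) (u (a + 1)) = 1 := by omega
          have l := hlip (u a) (u (a + 1))
          rw [e'] at l
          have t := dist_triangle (f x) (f (u a)) (f (u (a + 1)))
          push_cast at l
          rw [abs_le]; constructor <;> linarith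
    obtain ⟨q, hq1, hq2⟩ := hq
    refine ⟨q, hq1, ?_⟩
    have b := hbet x q z hq1
    rw [abs_le] at hq2
    rcases four_point H (f x) (f p) (f z) (f q) with h | h
    · rw [dist_comm (f z) (f q)] at h
      linarith
    · linarith
  set K' := K + 2 * δ with hK'
  have hK'0 : 0 ≤ K' := by positivity
  set C0 := K + K' + (K' + L) + 2 * δ with hC0
  have hC00 : 0 ≤ C0 := by positivity
  refine slim_hyperbolic _ (fun x => by simp) (fun x y => by rw [SimpleGraph.dist_comm])
    (fun x y z => by exact_mod_cast hc.dist_triangle) ?_ (A * C0 + B) (by positivity) ?_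
  · intro x y
    obtain ⟨u, h0, -, h2, h3⟩ := graph_geo hc x x y (by simp)
    refine ⟨Γ.dist x y, u, h0, h2, fun i hi => ?_, fun i hi => ?_⟩
    · have e1 := h3 0 i (by omega) hi
      have e2 := h3 i (Γ.dist x y) hi le_rfl
      rw [h0] at e1
      rw [h2] at e2
      have : Γ.dist x (u i) + Γ.dist (u i) y = Γ.dist x y := by omega
      exact_mod_cast this
    · have e := h3 i (i + 1) (by omega) (by omega)
      have : Γ.dist (u i) (u (i + 1)) ≤ 1 := by omega
      exact_mod_cast this
  · intro x y z p hp
    have hp' : Γ.dist x p + Γ.dist p y = Γ.dist x y := by exact_mod_cast hp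
    have b := hbet x p y hp'
    have fin : ∀ q, dist (f p) (f q) ≤ C0 → (Γ.dist p q : ℝ) ≤ A * C0 + B := fun q hq =>
      (hco p q).trans (by have := mul_le_mul_of_nonneg_left hq hA; linarith)
    rcases four_point H (f x) (f z) (f y) (f p) with h | h
    · obtain ⟨q, hq1, hq2⟩ := hclose K' hK'0 x p z (by
        rw [dist_comm (f p) (f z)]; rw [dist_comm (f y) (f p)] at h; linarith)
      exact ⟨q, fin q hq2, Or.inl (by exact_mod_cast hq1)⟩
    · obtain ⟨q, hq1, hq2⟩ := hclose K' hK'0 z p y (by linarith)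
      exact ⟨q, fin q hq2, Or.inr (by exact_mod_cast hq1)⟩

section action
variable {G : Type*} [Group G] [MulAction G X]

/-- A maximal family of points whose orbits are `r`-separated. -/
theorem exists_orbit_net (hiso : ∀ g : G, Isometry (fun x : X => g • x)) (r : ℝ) (hr : 0 < r) :
    ∃ Y : Set X, (∀ y ∈ Y, ∀ z ∈ Y, y ≠ z → ∀ g : G, r ≤ dist (g • y) z) ∧
      ∀ x : X, ∃ y ∈ Y, ∃ g : G, dist (g • y) x ≤ r := by
  obtain ⟨Y, hY⟩ := zorn_subset
    {Y : Set X | ∀ y ∈ Y, ∀ z ∈ Y, y ≠ z → ∀ g : G, r ≤ dist (g • y) z} (by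
      intro c hc hchain
      refine ⟨⋃₀ c, ?_, fun s hs => Set.subset_sUnion_of_mem hs⟩
      rintro y ⟨s, hs, hy⟩ z ⟨t, ht, hz⟩ hyz g
      rcases hchain.total hs ht with h | h
      · exact hc ht y (h hy) z hz hyz g
      · exact hc hs y hy z (h hz) hyz g)
  refine ⟨Y, hY.prop, fun x => ?_⟩
  by_contra hcon
  push Not at hcon
  have hxY : x ∉ Y := fun hx => by
    have := hcon x hx 1
    rw [one_smul, dist_self] at this
    linarith
  have hins : insert x Y ∈ {Y : Set X | ∀ y ∈ Y, ∀ z ∈ Y, y ≠ z → ∀ g : G, r ≤ dist (g • y) z} := by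
    rintro y (rfl | hy) z (rfl | hz) hyz g
    · exact absurd rfl hyz
    · have h1 := hcon z hz g⁻¹
      have h2 := (hiso g).dist_eq (g⁻¹ • z) y
      simp only [smul_inv_smul] at h2
      rw [dist_comm, h2]; exact h1.le
    · exact (hcon y hy g).le
    · exact hY.prop y hy z hz hyz g
  exact hxY (hY.le_of_ge hins (Set.subset_insert x Y) (Set.mem_insert x Y))

theorem encard_ball_bound (hiso : ∀ g : G, Isometry (fun x : X => g • x))
    (hup : UniformlyProper G X) (r : ℝ) (hr : 0 < r) (Y : Set X)
    (hY : ∀ y ∈ Y, ∀ z ∈ Y, y ≠ z → ∀ g : G, r ≤ dist (g • y) z)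
    (R : ℝ) (hR : 0 < R) (N : ℕ)
    (hN : ∀ (x : X) (S : Set X), S ⊆ Metric.closedBall x R → IsSeparatedSubset r S →
      S.encard ≤ N) :
    ∃ d : ℕ, ∀ x : X, {v : G × Y | dist x (v.1 • (v.2 : X)) ≤ R}.encard ≤ d := by
  classical
  obtain ⟨N2, hN2⟩ := hup (2 * R) (by positivity)
  refine ⟨N * N2, fun x => ?_⟩
  set T : Set Y := {y | ∃ g : G, dist x (g • (y : X)) ≤ R} with hT
  have hch : ∀ y : Y, ∃ g : G, y ∈ T → dist x (g • (y : X)) ≤ R := by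
    intro y
    by_cases hy : y ∈ T
    · obtain ⟨g, hg⟩ := hy
      exact ⟨g, fun _ => hg⟩
    · exact ⟨1, fun h => absurd h hy⟩
  choose γ hγ using hch
  have hsep : ∀ y z : Y, y ≠ z → r ≤ dist (γ y • (y : X)) (γ z • (z : X)) := by
    intro y z hyz
    have h1 := hY y y.2 z z.2 (fun h => hyz (Subtype.ext h)) ((γ z)⁻¹ * γ y)
    have h2 := (hiso (γ z)).dist_eq (((γ z)⁻¹ * γ y) • (y : X)) z
    simp only [smul_smul, mul_inv_cancel_left] at h2
    rw [h2]; exact h1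
  have hTc : T.encard ≤ N := by
    have hinj : Set.InjOn (fun y : Y => γ y • (y : X)) T := by
      intro y _ z _ hyz
      by_contra hne
      have := hsep y z hne
      simp only at hyz
      rw [hyz, dist_self] at this
      linarith
    rw [← hinj.encard_image]
    refine hN x _ ?_ ?_
    · rintro _ ⟨y, hy, rfl⟩
      rw [Metric.mem_closedBall, dist_comm]
      exact hγ y hy
    · rintro _ ⟨y, hy, rfl⟩ _ ⟨z, hz, rfl⟩ hne
      exact hsep y z (fun h => hne (by rw [h]))
  have hTf : T.Finite := Set.finite_of_encard_le_coe hTc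
  have hfib : ∀ y ∈ T, {v : G × Y | v.2 = y ∧ dist x (v.1 • (v.2 : X)) ≤ R}.encard ≤ N2 := by
    intro y hy
    have hsub : {v : G × Y | v.2 = y ∧ dist x (v.1 • (v.2 : X)) ≤ R} ⊆
        (fun h : G => (h * γ y, y)) ''
          {h : G | dist (γ y • (y : X)) (h • γ y • (y : X)) ≤ 2 * R} := by
      rintro ⟨g, z⟩ ⟨hz, hd⟩
      simp only at hz hd
      subst hz
      refine ⟨g * (γ z)⁻¹, ?_, by simp⟩
      simp only [Set.mem_setOf_eq, smul_smul, inv_mul_cancel_right]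
      have := dist_triangle_left (γ z • (z : X)) (g • (z : X)) x
      have := hγ z hy
      linarith
    exact (Set.encard_le_encard hsub).trans ((Set.encard_image_le _ _).trans (hN2 _))
  have hcov : {v : G × Y | dist x (v.1 • (v.2 : X)) ≤ R} ⊆
      ⋃ y ∈ hTf.toFinset, {v : G × Y | v.2 = y ∧ dist x (v.1 • (v.2 : X)) ≤ R} := by
    rintro ⟨g, y⟩ hv
    simp only [Set.mem_iUnion]
    exact ⟨y, hTf.mem_toFinset.2 ⟨g, hv⟩, rfl, hv⟩
  calc _ ≤ _ := Set.encard_le_encard hcov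
    _ ≤ ∑ y ∈ hTf.toFinset, {v : G × Y | v.2 = y ∧ dist x (v.1 • (v.2 : X)) ≤ R}.encard :=
        Finset.set_encard_biUnion_le _ _
    _ ≤ ∑ y ∈ hTf.toFinset, (N2 : ℕ∞) :=
        Finset.sum_le_sum (fun y hy => hfib y (hTf.mem_toFinset.1 hy))
    _ = T.encard * N2 := by
        rw [Finset.sum_const, nsmul_eq_mul, hTf.encard_eq_coe_toFinset_card]
    _ ≤ N * N2 := by gcongr
    _ = ((N * N2 : ℕ) : ℕ∞) := by push_cast; rfl

end action

/-- Walks in the Rips type graph on a net. -/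
theorem exists_short_walk (hl : IsLengthSpace X) {V : Type*} (Γ : SimpleGraph V) (f : V → X)
    (r : ℝ) (hr : 0 < r) (hdense : ∀ x, ∃ v, dist (f v) x ≤ r)
    (hadj : ∀ v w, v ≠ w → dist (f v) (f w) ≤ 2 * r + 1 → Γ.Adj v w) (w : V) (n : ℕ) :
    ∀ (x : X) (v : V), dist x (f w) ≤ n / 4 → dist (f v) x ≤ r →
      ∃ p : Γ.Walk v w, p.length ≤ n + 1 := by
  have hone : ∀ a b, dist (f a) (f b) ≤ 2 * r + 1 → ∃ p : Γ.Walk a b, p.length ≤ 1 := by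
    intro a b hab
    by_cases h : a = b
    · subst h; exact ⟨SimpleGraph.Walk.nil, by simp⟩
    · exact ⟨(hadj a b h hab).toWalk, by simp⟩
  induction n with
  | zero =>
    intro x v hx hv
    obtain ⟨p, hp⟩ := hone v w (by
      have := dist_triangle (f v) x (f w)
      push_cast at hx; linarith)
    exact ⟨p, by omega⟩
  | succ n ih =>
    intro x v hx hv
    push_cast at hx
    have hp : ∃ y, dist x y ≤ 1 ∧ dist y (f w) ≤ n / 4 := by
      by_cases h : dist x (f w) ≤ n / 4
      · exact ⟨x, by simp, h⟩
      · obtain ⟨m, p, h0, hm, hs, hg⟩ := length_chain hl x (f w) (1 / 4) (by norm_num)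
        obtain ⟨a, ha, g1, g2⟩ := exists_jump (fun i => dist (p i) (f w) ≤ n / 4) m
          (by rw [h0]; exact h) (by rw [hm, dist_self]; positivity)
        refine ⟨p (a + 1), ?_, g2⟩
        have e1 := hs a ha
        have e2 := hg 0 a m (by omega) ha.le le_rfl
        rw [h0, hm] at e2
        have e3 := dist_triangle x (p a) (p (a + 1))
        have g1' := not_le.1 g1
        linarith
    obtain ⟨y, hy1, hy2⟩ := hp
    obtain ⟨v', hv'⟩ := hdense y
    obtain ⟨p, hp⟩ := ih y v' hy2 hv'
    obtain ⟨q, hq⟩ := hone v v' (by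
      have t1 := dist_triangle (f v) x (f v')
      have t2 := dist_triangle x y (f v')
      rw [dist_comm y (f v')] at t2
      linarith)
    exact ⟨q.append p, by rw [SimpleGraph.Walk.length_append]; omega⟩

theorem dist_le_walk {V : Type*} (Γ : SimpleGraph V) (f : V → X) (L : ℝ)
    (h : ∀ v w, Γ.Adj v w → dist (f v) (f w) ≤ L) {v w : V} (p : Γ.Walk v w) :
    dist (f v) (f w) ≤ L * p.length := by
  induction p with
  | nil => simp
  | @cons a b c hab p ih =>
    have t := dist_triangle (f a) (f b) (f c)
    have := h a b hab
    rw [SimpleGraph.Walk.length_cons]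
    push_cast
    linarith

end GH

/-- If a group `G` acts by isometries, uniformly properly, on a nonempty Gromov hyperbolic
length space with bounded geometry, then `G` acts freely on the vertex set of a connected
`G`-invariant simple graph with uniformly bounded degrees whose graph metric is Gromov
hyperbolic. -/
theorem uniformlyProper_on_boundedGeometry_gives_graph
    (G X : Type) [Group G] [MetricSpace X] [MulAction G X]
    (hne : Nonempty X)
    (hiso : ∀ g : G, Isometry (fun x : X => g • x))
    (hup : UniformlyProper G X)
    (hhyp : IsGromovHyperbolic X)
    (hlength : IsLengthSpace X)
    (hbg : HasBoundedGeometry X) :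
    ∃ (V : Type) (act : G → V → V) (Γ : SimpleGraph V),
      (∀ v : V, act 1 v = v) ∧
      (∀ (g h : G) (v : V), act (g * h) v = act g (act h v)) ∧
      (∀ (g : G) (v : V), act g v = v → g = 1) ∧
      (∀ (g : G) (v w : V), Γ.Adj v w → Γ.Adj (act g v) (act g w)) ∧
      Γ.Connected ∧
      (∃ d : ℕ, ∀ v : V, (Γ.neighborSet v).encard ≤ d) ∧
      IsGromovHyperbolicFun (fun v w : V => (Γ.dist v w : ℝ)) := by
  obtain ⟨r, hr, hbg⟩ := hbg
  obtain ⟨Y, hY, hdense⟩ := GH.exists_orbit_net hiso r hr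
  obtain ⟨N, hN⟩ := hbg (2 * r + 1) (by positivity)
  obtain ⟨d, hd⟩ := GH.encard_ball_bound hiso hup r hr Y hY (2 * r + 1) (by positivity) N hN
  let f : G × Y → X := fun v => v.1 • (v.2 : X)
  have hfd : ∀ x, ∃ v, dist (f v) x ≤ r := by
    intro x
    obtain ⟨y, hy, g, hg⟩ := hdense x
    exact ⟨(g, ⟨y, hy⟩), hg⟩
  let Γ : SimpleGraph (G × Y) :=
    { Adj := fun v w => v ≠ w ∧ dist (f v) (f w) ≤ 2 * r + 1
      symm := ⟨fun v w h => ⟨h.1.symm, by rw [dist_comm]; exact h.2⟩⟩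
      loopless := ⟨fun v h => h.1 rfl⟩ }
  have hwalk := GH.exists_short_walk hlength Γ f r hr hfd (fun v w h1 h2 => ⟨h1, h2⟩)
  have hwalk' : ∀ v w, ∃ p : Γ.Walk v w, (p.length : ℝ) ≤ 4 * dist (f v) (f w) + 2 := by
    intro v w
    obtain ⟨p, hp⟩ := hwalk w ⌈4 * dist (f v) (f w)⌉₊ (f v) v
      (by have := Nat.le_ceil (4 * dist (f v) (f w)); linarith) (by rw [dist_self]; exact hr.le)
    refine ⟨p, ?_⟩
    have h1 : (p.length : ℝ) ≤ (⌈4 * dist (f v) (f w)⌉₊ : ℝ) + 1 := by exact_mod_cast hp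
    have h2 := Nat.ceil_lt_add_one (show 0 ≤ 4 * dist (f v) (f w) by positivity)
    linarith
  have hconn : Γ.Connected := by
    obtain ⟨x⟩ := hne
    obtain ⟨v, -⟩ := hfd x
    haveI : Nonempty (G × Y) := ⟨v⟩
    exact SimpleGraph.Connected.mk fun v w => (hwalk' v w).choose.reachable
  refine ⟨G × Y, fun g v => (g * v.1, v.2), Γ, ?_, ?_, ?_, ?_, hconn, ⟨d, ?_⟩, ?_⟩
  · intro v; simp
  · intro g h v; simp [mul_assoc]
  · intro g v h
    have := congrArg Prod.fst h
    simpa using this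
  · rintro g v w ⟨h1, h2⟩
    refine ⟨fun h => h1 ?_, ?_⟩
    · simp only [Prod.mk.injEq, mul_right_inj] at h
      exact Prod.ext h.1 h.2
    · have := (hiso g).dist_eq (f v) (f w)
      simp only [f, mul_smul] at this h2 ⊢
      rw [this]; exact h2
  · intro v
    refine (Set.encard_le_encard ?_).trans (hd (f v))
    intro w hw
    exact hw.2
  · refine GH.graph_hyperbolic hhyp hlength hconn f (L := 2 * r + 1) (A := 4) (B := 2)
      (by positivity) (by norm_num) (by norm_num) ?_ ?_
    · intro v w
      obtain ⟨p, hp⟩ := hconn.exists_walk_length_eq_dist v w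
      rw [← hp]
      exact GH.dist_le_walk Γ f _ (fun v w h => h.2) p
    · intro v w
      obtain ⟨p, hp⟩ := hwalk' v w
      have : (Γ.dist v w : ℝ) ≤ p.length := by exact_mod_cast SimpleGraph.dist_le p
      linarith
end

section
/- Let H be a group and c ∈ H an element such that: (i) roots in H are unique, i.e. for all x, y ∈ H and every nonzero integer k, x^k = y^k implies x = y; (ii) the centralizer of c in H equals the cyclic subgroup ⟨c⟩ generated by c; (iii) for every u ∈ H and all nonzero integers k, ℓ, if c^k = u c^ℓ u⁻¹ then k = ℓ. Let N be a subgroup of H, let n be a nonzero integer, let a = c^n, and let h ∈ H be such that h is not of the form c^m t with m ∈ ℤ and t ∈ N. Set b = h⁻¹ a h. Then a and b are not commensurable in N, i.e. there do not exist nonzero integers k, ℓ and u ∈ N with a^k = u b^ℓ u⁻¹. -/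
/-- Let `H` be a group with unique roots in which the centralizer of `c` is `⟨c⟩` and in
which `c^k` conjugate to `c^ℓ` (with `k, ℓ ≠ 0`) forces `k = ℓ`. Let `N ≤ H`, let
`a = c^n` with `n ≠ 0`, and let `h ∈ H` not be of the form `c^m t` with `t ∈ N`. Then
`a` and `b = h⁻¹ a h` are not commensurable in `N`: there are no nonzero integers
`k, ℓ` and `u ∈ N` with `a^k = u b^ℓ u⁻¹`. -/
theorem not_commensurable_of_conjugate
    (H : Type) [Group H] (c : H)
    (hroots : ∀ (x y : H) (k : ℤ), k ≠ 0 → x ^ k = y ^ k → x = y)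
    (hcent : Subgroup.centralizer {c} = Subgroup.zpowers c)
    (hpowconj : ∀ (u : H) (k l : ℤ), k ≠ 0 → l ≠ 0 →
      c ^ k = u * c ^ l * u⁻¹ → k = l)
    (N : Subgroup H) (n : ℤ) (hn : n ≠ 0) (a : H) (ha : a = c ^ n)
    (h : H) (hh : ¬ ∃ (m : ℤ) (t : H), t ∈ N ∧ h = c ^ m * t)
    (b : H) (hb : b = h⁻¹ * a * h) :
    ¬ ∃ (k l : ℤ) (u : H), k ≠ 0 ∧ l ≠ 0 ∧ u ∈ N ∧ a ^ k = u * b ^ l * u⁻¹ := by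
  rintro ⟨k, l, u, hk, hl, hu, e⟩
  have hb' : b ^ l = h⁻¹ * c ^ (n * l) * h := by
    have h1 := conj_zpow (i := l) (a := h⁻¹) (b := a)
    rw [inv_inv] at h1
    rw [hb, h1, ha, zpow_mul]
  have e1 : c ^ (n * k) = (u * h⁻¹) * c ^ (n * l) * (u * h⁻¹)⁻¹ := by
    rw [zpow_mul, ← ha, e, hb']
    group
  have hkl := hpowconj _ _ _ (mul_ne_zero hn hk) (mul_ne_zero hn hl) e1
  rw [← hkl, ← conj_zpow] at e1
  have e2 := hroots _ _ _ (mul_ne_zero hn hk) e1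
  have hv : u * h⁻¹ ∈ Subgroup.centralizer {c} := by
    rw [Subgroup.mem_centralizer_singleton_iff]
    first
      | exact (eq_mul_inv_iff_mul_eq.mp e2)
      | exact (eq_mul_inv_iff_mul_eq.mp e2).symm
  rw [hcent] at hv
  obtain ⟨m, hm⟩ := Subgroup.mem_zpowers_iff.mp hv
  refine hh ⟨-m, u, hu, ?_⟩
  rw [zpow_neg, hm]
  group
end

section
/- Let H be a group and N a normal subgroup of H which is finitely generated as a group, and suppose the quotient group H/N is simple and infinite. Let a ∈ N, let h ∈ H, and let b = h⁻¹ a h (which lies in N since N is normal). Then a and b are conjugate in every finite quotient of N: for every finite group F and every group homomorphism φ : N → F, the elements φ(a) and φ(b) are conjugate in F. -/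
/-- There are finitely many homomorphisms from a finitely generated group to a finite group. -/
theorem finite_hom_of_fg (N F : Type) [Group N] [Group F] [Finite F] (hfg : Group.FG N) :
    Finite (N →* F) := by
  obtain ⟨S, hS⟩ := Group.fg_def.1 hfg
  refine Finite.of_injective (fun (f : N →* F) (s : S) => f s) ?_
  intro f g hfgS
  refine MonoidHom.eq_of_eqOn_dense hS ?_
  intro x hx
  exact congrFun hfgS ⟨x, hx⟩

/-- The action of `H` on `Hom(N, F)` by precomposition with conjugation. -/
def homPermAction (H : Type) [Group H] (N : Subgroup H) [N.Normal] (F : Type) [Group F] :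
    H →* Equiv.Perm (↥N →* F) :=
  MonoidHom.toHomPerm
    { toFun := fun g φ => φ.comp (MulAut.conjNormal (H := N) g⁻¹).toMonoidHom
      map_one' := by
        funext φ
        ext x
        simp
        rfl
      map_mul' := by
        intro g g'
        funext φ
        ext x
        simp
        rfl }

/-- Let `N` be a finitely generated normal subgroup of `H` with `H/N` infinite and simple.
If `a ∈ N` and `b = h⁻¹ a h` for some `h ∈ H`, then the images of `a` and `b` are
conjugate in every finite quotient of `N`. -/
theorem conjugate_in_every_finite_quotient
    (H : Type) [Group H] (N : Subgroup H) [N.Normal]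
    (hfg : Group.FG N)
    (hsimple : IsSimpleGroup (H ⧸ N)) (hinf : Infinite (H ⧸ N))
    (a : ↥N) (h : H) (b : ↥N) (hb : (b : H) = h⁻¹ * (a : H) * h)
    (F : Type) [Group F] [Finite F] (φ : ↥N →* F) :
    IsConj (φ a) (φ b) := by
  have := finite_hom_of_fg N F hfg
  set ψ := homPermAction H N F with hψ
  have hnorm : (ψ.ker.map (QuotientGroup.mk' N)).Normal :=
    Subgroup.Normal.map inferInstance _ (QuotientGroup.mk'_surjective N)
  have hfi : ψ.ker.FiniteIndex := inferInstance
  rcases hnorm.eq_bot_or_eq_top with hbot | htop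
  · exfalso
    have hle : ψ.ker ≤ N := by
      have := (Subgroup.map_eq_bot_iff _).1 hbot
      simpa using this
    have : N.FiniteIndex := Subgroup.finiteIndex_of_le hle
    exact not_finite (H ⧸ N)
  · have hm : (QuotientGroup.mk' N h) ∈ ψ.ker.map (QuotientGroup.mk' N) := by
      rw [htop]; trivial
    obtain ⟨k, hk, hkh⟩ := hm
    have hn : k⁻¹ * h ∈ N := QuotientGroup.eq.1 hkh
    have hφ : ψ k φ = φ := by
      rw [MonoidHom.mem_ker.1 hk]; rfl
    have hka : φ (MulAut.conjNormal (H := N) k⁻¹ a) = φ a := DFunLike.congr_fun hφ a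
    have hbe : b = (⟨k⁻¹ * h, hn⟩ : N)⁻¹ * MulAut.conjNormal (H := N) k⁻¹ a * ⟨k⁻¹ * h, hn⟩ := by
      ext
      simp [hb, mul_assoc]
    rw [isConj_iff]
    refine ⟨(φ ⟨k⁻¹ * h, hn⟩)⁻¹, ?_⟩
    rw [hbe, map_mul, map_mul, map_inv, hka, inv_inv]
end

section
/- Let N be a group and let a, b ∈ N be elements such that for every finite group F and every homomorphism φ : N → F, the elements φ(a) and φ(b) are conjugate in F. Let p and q be coprime positive integers, let K be the normal closure in N of the set {a^p, b^q}, let G = N/K, and let π : N → G be the quotient map. Then for every finite group F and every homomorphism ψ : G → F, one has ψ(π(a)) = 1 and ψ(π(b)) = 1. Moreover, if in addition N equals the normal closure of {a} in N, then every homomorphism from G to any finite group is trivial. -/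
/-- Let `a, b ∈ N` be conjugate in every finite quotient of `N`, let `p, q` be coprime
positive integers, and let `G = N / ⟨⟨a^p, b^q⟩⟩`. Then the images of `a` and `b` are
killed by every homomorphism from `G` to a finite group; moreover, if `N` is the normal
closure of `{a}`, then every homomorphism from `G` to any finite group is trivial. -/
theorem images_trivial_in_finite_quotients
    (N : Type) [Group N] (a b : N)
    (hconj : ∀ (F : Type) [Group F] [Finite F] (φ : N →* F), IsConj (φ a) (φ b))
    (p q : ℕ) (hp : 0 < p) (hq : 0 < q) (hpq : Nat.Coprime p q) :
    (∀ (F : Type) [Group F] [Finite F]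
        (ψ : N ⧸ Subgroup.normalClosure {a ^ p, b ^ q} →* F),
        ψ (QuotientGroup.mk a) = 1 ∧ ψ (QuotientGroup.mk b) = 1) ∧
      (Subgroup.normalClosure {a} = ⊤ →
        ∀ (F : Type) [Group F] [Finite F]
          (ψ : N ⧸ Subgroup.normalClosure {a ^ p, b ^ q} →* F)
          (g : N ⧸ Subgroup.normalClosure {a ^ p, b ^ q}), ψ g = 1) := by
  have key : ∀ (F : Type) [Group F] [Finite F]
        (ψ : N ⧸ Subgroup.normalClosure {a ^ p, b ^ q} →* F),
        ψ (QuotientGroup.mk a) = 1 ∧ ψ (QuotientGroup.mk b) = 1 := by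
    intro F _ _ ψ
    have hc : IsConj (ψ (QuotientGroup.mk a)) (ψ (QuotientGroup.mk b)) :=
      hconj F (ψ.comp (QuotientGroup.mk' _))
    have ha : (ψ (QuotientGroup.mk a)) ^ p = 1 := by
      rw [← map_pow, ← QuotientGroup.mk_pow,
        (QuotientGroup.eq_one_iff (a ^ p)).2 (Subgroup.subset_normalClosure (by simp)), map_one]
    have hb : (ψ (QuotientGroup.mk b)) ^ q = 1 := by
      rw [← map_pow, ← QuotientGroup.mk_pow,
        (QuotientGroup.eq_one_iff (b ^ q)).2 (Subgroup.subset_normalClosure (by simp)), map_one]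
    obtain ⟨c, hc⟩ := isConj_iff.1 hc
    have hb' : (ψ (QuotientGroup.mk b)) ^ p = 1 := by
      rw [← hc, conj_pow, ha]; simp
    have h1 : ψ (QuotientGroup.mk b) = 1 := by
      have := pow_gcd_eq_one.2 ⟨hb', hb⟩
      rwa [hpq, pow_one] at this
    refine ⟨?_, h1⟩
    rw [h1] at hc
    simpa using hc
  refine ⟨key, ?_⟩
  intro hN F _ _ ψ g
  obtain ⟨x, rfl⟩ := QuotientGroup.mk_surjective g
  have hle : Subgroup.normalClosure {a} ≤ (ψ.comp (QuotientGroup.mk' _)).ker :=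
    Subgroup.normalClosure_le_normal (by
      rw [Set.singleton_subset_iff]
      exact (key F ψ).1)
  rw [hN] at hle
  exact hle (Subgroup.mem_top x)
end
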